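/- Let (A, B) be a clean optimal pair and let (A', B') be a redistribution of (A, B). Then cost(A') + cost(B') = cost(A) + cost(B). -/

import Mathlib

open Finset

noncomputable section

/-- Cost of the assignment `π` (customer `j` is assigned to supplier `π j`)
when the suppliers in `A` are upgraded. -/
def assignCost {n : ℕ} (b c d : Fin n → ℝ) (A : Finset (Fin n))
    (π : Equiv.Perm (Fin n)) : ℝ :=
  ∑ j, (if π j ∈ A then b (π j) else c (π j)) * d j

/-- `cost A` : minimum assignment cost when upgrading the suppliers in `A`. -/
def cost {n : ℕ} (b c d : Fin n → ℝ) (A : Finset (Fin n)) : ℝ :=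
  Finset.univ.inf' Finset.univ_nonempty (assignCost b c d A)

/-- The LP feasible region `P(k)`. -/
def Pk (n k : ℕ) : Set ((Fin n → Fin n → ℝ) × (Fin n → Fin n → ℝ)) :=
  {p | (∀ i j, 0 ≤ p.1 i j) ∧ (∀ i j, 0 ≤ p.2 i j) ∧
    (∀ j, ∑ i, (p.1 i j + p.2 i j) = 1) ∧
    (∀ i, ∑ j, (p.1 i j + p.2 i j) = 1) ∧
    (∑ i, ∑ j, p.1 i j) ≤ (k : ℝ)}

/-- The LP objective. -/
def obj {n : ℕ} (b c d : Fin n → ℝ)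
    (p : (Fin n → Fin n → ℝ) × (Fin n → Fin n → ℝ)) : ℝ :=
  ∑ i, ∑ j, (b i * p.1 i j + c i * p.2 i j) * d j

/-- A point is integral if all of its entries lie in `{0, 1}`. -/
def Integral {n : ℕ} (p : (Fin n → Fin n → ℝ) × (Fin n → Fin n → ℝ)) : Prop :=
  (∀ i j, p.1 i j = 0 ∨ p.1 i j = 1) ∧ (∀ i j, p.2 i j = 0 ∨ p.2 i j = 1)

/-- `f_{A,B}(k)`. -/
def fpair {n : ℕ} (b c d : Fin n → ℝ) (k : ℕ) (A B : Finset (Fin n)) : ℝ :=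
  (((B.card : ℝ) - k) * cost b c d A + ((k : ℝ) - A.card) * cost b c d B) /
    ((B.card : ℝ) - A.card)

/-- `(A, B)` is an optimal pair. -/
def OptimalPair {n : ℕ} (b c d : Fin n → ℝ) (k : ℕ) (A B : Finset (Fin n)) : Prop :=
  A.card < k ∧ k < B.card ∧ IsLeast (obj b c d '' Pk n k) (fpair b c d k A B)

/-- `X` is simple: some optimal assignment for upgrading `X` assigns every
upgraded supplier to a customer with positive demand. -/
def SimpleSet {n : ℕ} (b c d : Fin n → ℝ) (X : Finset (Fin n)) : Prop :=
  ∃ π : Equiv.Perm (Fin n), assignCost b c d X π = cost b c d X ∧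
    ∀ j, π j ∈ X → 0 < d j

/-- `(A, B)` is clean. -/
def Clean {n : ℕ} (b c : Fin n → ℝ) (A B : Finset (Fin n)) : Prop :=
  ∀ i ∈ symmDiff A B, ∀ i' ∈ symmDiff A B, ¬ (b i < b i' ∧ c i' < c i)

/-- `(A', B')` is a redistribution of `(A, B)` : the elements of `A ∆ B` are
enumerated `e 0, e 1, …` with `b` and `c` both nondecreasing along the
enumeration, the elements with odd (0-based) index go to `A'` and those with
even (0-based) index go to `B'` (on top of `A ∩ B`). -/
def Redistribution {n : ℕ} (b c : Fin n → ℝ) (A B A' B' : Finset (Fin n)) : Prop :=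
  ∃ (ℓ : ℕ) (e : Fin ℓ → Fin n), Function.Injective e ∧
    Finset.image e Finset.univ = symmDiff A B ∧
    Monotone (b ∘ e) ∧ Monotone (c ∘ e) ∧
    A' = (A ∩ B) ∪
      Finset.image e ((Finset.univ : Finset (Fin ℓ)).filter (fun s => (s : ℕ) % 2 = 1)) ∧
    B' = (A ∩ B) ∪
      Finset.image e ((Finset.univ : Finset (Fin ℓ)).filter (fun s => (s : ℕ) % 2 = 0))

/-- The 0/1 point of the LP corresponding to assignment `π` with upgraded set `A`. -/
def chi {n : ℕ} (π : Equiv.Perm (Fin n)) (A : Finset (Fin n)) :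
    (Fin n → Fin n → ℝ) × (Fin n → Fin n → ℝ) :=
  (fun i j => if π j = i ∧ i ∈ A then 1 else 0,
   fun i j => if π j = i ∧ i ∉ A then 1 else 0)

/-- `hval k'` : minimum of `cost X` over all `X` of cardinality `k'`. -/
def hval {n : ℕ} (b c d : Fin n → ℝ) (k' : ℕ) : ℝ :=
  sInf {v | ∃ X : Finset (Fin n), X.card = k' ∧ cost b c d X = v}

end

/-- The cost of supplier `i` when the suppliers in `X` are upgraded. -/
def effCost {n : ℕ} (b c : Fin n → ℝ) (X : Finset (Fin n)) (i : Fin n) : ℝ :=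
  if i ∈ X then b i else c i

lemma sum_le_sum_of_forall_notMem {ι : Type*} [DecidableEq ι] {f : ι → ℝ} {S T : Finset ι}
    (hcard : T.card = S.card) (h : ∀ t ∈ T, ∀ s, s ∉ T → f t ≤ f s) :
    ∑ i ∈ T, f i ≤ ∑ i ∈ S, f i := by
  have hc : (T \ S).card = (S \ T).card := Finset.card_sdiff_comm hcard
  have hd : ∑ i ∈ T \ S, f i ≤ ∑ i ∈ S \ T, f i := by
    rcases (S \ T).eq_empty_or_nonempty with h0 | h0
    · have : T \ S = ∅ := by rw [← Finset.card_eq_zero, hc, h0, Finset.card_empty]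
      simp [h0, this]
    · obtain ⟨s₀, hs₀, hmin⟩ := Finset.exists_min_image (S \ T) f h0
      calc ∑ i ∈ T \ S, f i ≤ (T \ S).card • f s₀ :=
            Finset.sum_le_card_nsmul _ _ _ fun t ht =>
              h t (Finset.mem_sdiff.1 ht).1 s₀ (Finset.mem_sdiff.1 hs₀).2
        _ = (S \ T).card • f s₀ := by rw [hc]
        _ ≤ ∑ i ∈ S \ T, f i := Finset.card_nsmul_le_sum _ _ _ hmin
  rw [← Finset.sum_inter_add_sum_sdiff T S, ← Finset.sum_inter_add_sum_sdiff S T,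
    Finset.inter_comm S T]
  linarith

lemma last_mul_sum_le_sum_mul {n : ℕ} (w g : Fin (n + 1) → ℝ) (hg : Antitone g)
    (hw : ∀ m ≤ n, 0 ≤ ∑ r : Fin (n + 1), if (r : ℕ) < m then w r else 0) :
    g (Fin.last n) * ∑ r, w r ≤ ∑ r, w r * g r := by
  induction n with
  | zero => simp [mul_comm]
  | succ n ih =>
    have h1 := ih (fun r => w r.castSucc) (fun r => g r.castSucc)
      (fun i j hij => hg (by simpa using hij)) (fun m hm => by
        have := hw m (by omega)
        rw [Fin.sum_univ_castSucc] at this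
        simpa [show ¬ (n + 1 < m) by omega] using this)
    have h2 : 0 ≤ ∑ r : Fin (n + 1), w r.castSucc := by
      have := hw (n + 1) le_rfl
      rw [Fin.sum_univ_castSucc] at this
      simpa [Fin.is_le] using this
    have h3 : g (Fin.last (n + 1)) ≤ g (Fin.last n).castSucc := hg (Fin.le_last _)
    rw [Fin.sum_univ_castSucc, Fin.sum_univ_castSucc (fun r => w r * g r)]
    nlinarith [mul_le_mul_of_nonneg_right h3 h2]

lemma sum_mul_nonneg_of_antitone {n : ℕ} (w g : Fin n → ℝ) (hg : Antitone g) (hg0 : ∀ r, 0 ≤ g r)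
    (hw : ∀ m ≤ n, 0 ≤ ∑ r : Fin n, if (r : ℕ) < m then w r else 0) :
    0 ≤ ∑ r, w r * g r := by
  cases n with
  | zero => simp
  | succ n =>
    refine le_trans (mul_nonneg (hg0 _) ?_)
      (last_mul_sum_le_sum_mul w g hg fun m hm => hw m (by omega))
    have := hw (n + 1) le_rfl
    simpa [Fin.is_le] using this

lemma card_filter_lt_or_mod_two {ℓ x y ρ : ℕ} (hxy : x ≤ y) (hy : y ≤ ℓ) (hρ : ρ < 2) :
    (univ.filter fun s : Fin ℓ => (s : ℕ) < x ∨ ((s : ℕ) < y ∧ (s : ℕ) % 2 = ρ)).card =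
      x + ((y + 1 - ρ) / 2 - (x + 1 - ρ) / 2) := by
  have key : ∀ l : ℕ,
      ((range l).filter fun s => s < x ∨ (s < y ∧ s % 2 = ρ)).card =
        min l x + ((min l y + 1 - ρ) / 2 - (min l x + 1 - ρ) / 2) := by
    intro l
    induction l with
    | zero => simp
    | succ l ih =>
      rw [Finset.range_add_one, Finset.filter_insert]
      split_ifs with h
      · rw [Finset.card_insert_of_notMem (by simp), ih]
        omega
      · rw [ih]
        omega
  have := key ℓ
  rw [min_eq_right hy, min_eq_right (hxy.trans hy)] at this
  rw [← this, card_filter, card_filter]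
  exact Fin.sum_univ_eq_sum_range (fun s => if s < x ∨ (s < y ∧ s % 2 = ρ) then 1 else 0) ℓ

lemma cost_le_assignCost {n : ℕ} (b c d : Fin n → ℝ) (X : Finset (Fin n))
    (π : Equiv.Perm (Fin n)) : cost b c d X ≤ assignCost b c d X π :=
  Finset.inf'_le _ (Finset.mem_univ π)

lemma exists_assignCost_eq_cost {n : ℕ} (b c d : Fin n → ℝ) (X : Finset (Fin n)) :
    ∃ π, assignCost b c d X π = cost b c d X := by
  obtain ⟨π, -, h⟩ := Finset.exists_mem_eq_inf' Finset.univ_nonempty (assignCost b c d X)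
  exact ⟨π, h.symm⟩

lemma chi_add {n : ℕ} (π : Equiv.Perm (Fin n)) (X : Finset (Fin n)) (i j : Fin n) :
    (chi π X).1 i j + (chi π X).2 i j = if π j = i then 1 else 0 := by
  by_cases h : π j = i <;> by_cases h' : i ∈ X <;> simp [chi, h, h']

lemma sum_chi_fst {n : ℕ} (π : Equiv.Perm (Fin n)) (X : Finset (Fin n)) :
    ∑ i, ∑ j, (chi π X).1 i j = X.card := by
  have (i : Fin n) : ∑ j, (chi π X).1 i j = if i ∈ X then 1 else 0 := by
    rw [Finset.sum_eq_single (π.symm i)]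
    · simp [chi]
    · intro j _ hj
      have : π j ≠ i := fun h => hj (by simp [← h])
      simp [chi, this]
    · simp
  simp [this]

lemma obj_chi {n : ℕ} (b c d : Fin n → ℝ) (π : Equiv.Perm (Fin n)) (X : Finset (Fin n)) :
    obj b c d (chi π X) = assignCost b c d X π := by
  unfold obj assignCost
  rw [Finset.sum_comm]
  refine Finset.sum_congr rfl fun j _ => ?_
  rw [Finset.sum_eq_single (π j)]
  · by_cases h : π j ∈ X <;> simp [chi, h]
  · intro i _ hi
    simp [chi, hi.symm]
  · simp

lemma obj_add_smul {n : ℕ} (b c d : Fin n → ℝ) (s t : ℝ)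
    (p q : (Fin n → Fin n → ℝ) × (Fin n → Fin n → ℝ)) :
    obj b c d (s • p + t • q) = s * obj b c d p + t * obj b c d q := by
  simp only [obj, Finset.mul_sum, ← Finset.sum_add_distrib]
  refine Finset.sum_congr rfl fun i _ => Finset.sum_congr rfl fun j _ => ?_
  simp
  ring

lemma smul_chi_add_smul_chi_mem_Pk {n k : ℕ} (π ρ : Equiv.Perm (Fin n)) (X Y : Finset (Fin n))
    {s t : ℝ} (hs : 0 ≤ s) (ht : 0 ≤ t) (hst : s + t = 1) (hk : s * X.card + t * Y.card ≤ k) :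
    s • chi π X + t • chi ρ Y ∈ Pk n k := by
  have h1 (σ : Equiv.Perm (Fin n)) (Z : Finset (Fin n)) (i j) : 0 ≤ (chi σ Z).1 i j := by
    simp only [chi]; split_ifs <;> norm_num
  have h2 (σ : Equiv.Perm (Fin n)) (Z : Finset (Fin n)) (i j) : 0 ≤ (chi σ Z).2 i j := by
    simp only [chi]; split_ifs <;> norm_num
  have h3 (i j) : (s • chi π X + t • chi ρ Y).1 i j + (s • chi π X + t • chi ρ Y).2 i j =
      s * (if π j = i then 1 else 0) + t * (if ρ j = i then 1 else 0) := by
    rw [← chi_add π X, ← chi_add ρ Y]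
    simp
    ring
  have h4 (σ : Equiv.Perm (Fin n)) (i) : ∑ j, (if σ j = i then (1 : ℝ) else 0) = 1 := by
    simp [← Equiv.eq_symm_apply]
  refine ⟨fun i j => ?_, fun i j => ?_, fun j => ?_, fun i => ?_, ?_⟩
  · exact add_nonneg (mul_nonneg hs (h1 π X i j)) (mul_nonneg ht (h1 ρ Y i j))
  · exact add_nonneg (mul_nonneg hs (h2 π X i j)) (mul_nonneg ht (h2 ρ Y i j))
  · simp only [h3, Finset.sum_add_distrib, ← Finset.mul_sum]
    simpa using hst
  · simp only [h3, Finset.sum_add_distrib, ← Finset.mul_sum, h4]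
    simpa using hst
  · calc ∑ i, ∑ j, (s • chi π X + t • chi ρ Y).1 i j
        = s * (∑ i, ∑ j, (chi π X).1 i j) + t * ∑ i, ∑ j, (chi ρ Y).1 i j := by
          simp [Finset.sum_add_distrib, Finset.mul_sum]
      _ ≤ k := by rwa [sum_chi_fst, sum_chi_fst]

lemma le_convex_combination_cost {n k : ℕ} {b c d : Fin n → ℝ} {v : ℝ}
    (hv : IsLeast (obj b c d '' Pk n k) v) (X Y : Finset (Fin n))
    (hX : X.card ≤ k) (hY : k ≤ Y.card) (hXY : X.card < Y.card) :
    ((Y.card : ℝ) - X.card) * v ≤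
      ((Y.card : ℝ) - k) * cost b c d X + ((k : ℝ) - X.card) * cost b c d Y := by
  obtain ⟨π, hπ⟩ := exists_assignCost_eq_cost b c d X
  obtain ⟨ρ, hρ⟩ := exists_assignCost_eq_cost b c d Y
  have h1 : (X.card : ℝ) ≤ k := by exact_mod_cast hX
  have h2 : (k : ℝ) ≤ Y.card := by exact_mod_cast hY
  have h3 : 0 < (Y.card : ℝ) - X.card := sub_pos.2 (by exact_mod_cast hXY)
  have hmem := smul_chi_add_smul_chi_mem_Pk (k := k) π ρ X Y
    (s := ((Y.card : ℝ) - k) / (Y.card - X.card)) (t := ((k : ℝ) - X.card) / (Y.card - X.card))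
    (div_nonneg (by linarith) h3.le) (div_nonneg (by linarith) h3.le)
    (by field_simp; ring) (le_of_eq (by field_simp; ring))
  have := hv.2 ⟨_, hmem, rfl⟩
  rw [obj_add_smul, obj_chi, obj_chi, hπ, hρ, div_mul_eq_mul_div, div_mul_eq_mul_div, ← add_div,
    le_div_iff₀ h3] at this
  linarith

/-- The cost of any set lies above the line spanned by an optimal pair. -/
lemma OptimalPair.line_le {n k : ℕ} {b c d : Fin n → ℝ} {A B : Finset (Fin n)}
    (h : OptimalPair b c d k A B) (X : Finset (Fin n)) :
    ((B.card : ℝ) - X.card) * cost b c d A + ((X.card : ℝ) - A.card) * cost b c d B ≤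
      ((B.card : ℝ) - A.card) * cost b c d X := by
  obtain ⟨hA, hB, hv⟩ := h
  have hA' : (A.card : ℝ) < k := by exact_mod_cast hA
  have hB' : (k : ℝ) < B.card := by exact_mod_cast hB
  have hf : ((B.card : ℝ) - A.card) * fpair b c d k A B =
      ((B.card : ℝ) - k) * cost b c d A + ((k : ℝ) - A.card) * cost b c d B :=
    mul_div_cancel₀ _ (by linarith)
  rcases le_total X.card k with hX | hX
  · have := le_convex_combination_cost hv X B hX hB.le (by omega)
    have hX' : (X.card : ℝ) ≤ k := by exact_mod_cast hX
    have h1 := mul_le_mul_of_nonneg_left this (show 0 ≤ (B.card : ℝ) - A.card by linarith)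
    rw [mul_left_comm, hf] at h1
    refine le_of_mul_le_mul_left ?_ (sub_pos.2 hB')
    linarith
  · have := le_convex_combination_cost hv A X hA.le hX (by omega)
    have hX' : (k : ℝ) ≤ X.card := by exact_mod_cast hX
    have h1 := mul_le_mul_of_nonneg_left this (show 0 ≤ (B.card : ℝ) - A.card by linarith)
    rw [mul_left_comm, hf] at h1
    refine le_of_mul_le_mul_left ?_ (sub_pos.2 hA')
    linarith

lemma Redistribution.card_add_card {n : ℕ} {b c : Fin n → ℝ} {A B A' B' : Finset (Fin n)}
    (h : Redistribution b c A B A' B') : A'.card + B'.card = A.card + B.card := by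
  obtain ⟨ℓ, e, he, hD, -, -, rfl, rfl⟩ := h
  have hdisj (p : Fin ℓ → Prop) [DecidablePred p] :
      Disjoint (A ∩ B) (image e (univ.filter p)) := by
    rw [Finset.disjoint_left]
    intro i hi hi'
    have : i ∈ symmDiff A B := hD ▸ Finset.image_subset_image (Finset.filter_subset _ _) hi'
    simp only [Finset.mem_symmDiff, Finset.mem_inter] at this hi
    tauto
  rw [Finset.card_union_of_disjoint (hdisj _), Finset.card_union_of_disjoint (hdisj _),
    Finset.card_image_of_injective _ he, Finset.card_image_of_injective _ he]
  have h1 : (univ.filter fun s : Fin ℓ => (s : ℕ) % 2 = 1).card +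
      (univ.filter fun s : Fin ℓ => (s : ℕ) % 2 = 0).card = ℓ := by
    have := Finset.card_filter_add_card_filter_not (s := (univ : Finset (Fin ℓ)))
      (fun s => (s : ℕ) % 2 = 1)
    simpa using this
  have h2 : (symmDiff A B).card = ℓ := by
    rw [← hD, Finset.card_image_of_injective _ he, Finset.card_univ, Fintype.card_fin]
  have h3 : (symmDiff A B).card = (A \ B).card + (B \ A).card :=
    Finset.card_union_of_disjoint disjoint_sdiff_sdiff
  have h4 := Finset.card_inter_add_card_sdiff A B
  have h5 := Finset.card_inter_add_card_sdiff B A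
  rw [Finset.inter_comm] at h5
  omega

/-- Between the intersection and the union of two sets, the cardinalities can be rebalanced
without changing the total weight. -/
lemma exists_rebalance {ι : Type*} [DecidableEq ι] (S T : Finset ι) (g : ι → ℝ) {u : ℕ}
    (h1 : min S.card T.card ≤ u) (h2 : u ≤ max S.card T.card) :
    ∃ S' T', S' ⊆ S ∪ T ∧ T' ⊆ S ∪ T ∧ S'.card = u ∧ S'.card + T'.card = S.card + T.card ∧
      ∑ i ∈ S', g i + ∑ i ∈ T', g i = ∑ i ∈ S, g i + ∑ i ∈ T, g i := by
  have hV : (S ∩ T).card ≤ u := le_trans (le_min (card_le_card inter_subset_left)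
    (card_le_card inter_subset_right)) h1
  have hU : u ≤ (S ∪ T).card := le_trans h2 (max_le (card_le_card subset_union_left)
    (card_le_card subset_union_right))
  obtain ⟨W, hW1, hW2, hW⟩ := Finset.exists_subsuperset_card_eq
    (inter_subset_left.trans subset_union_left : S ∩ T ⊆ S ∪ T) hV hU
  have hdisj : Disjoint (S ∩ T) ((S ∪ T) \ W) :=
    Finset.disjoint_left.2 fun i hi hi' => (mem_sdiff.1 hi').2 (hW1 hi)
  refine ⟨W, (S ∩ T) ∪ ((S ∪ T) \ W), hW2,
    union_subset (inter_subset_left.trans subset_union_left) sdiff_subset, hW, ?_, ?_⟩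
  · rw [card_union_of_disjoint hdisj, ← card_union_add_card_inter S T,
      ← card_sdiff_add_card_eq_card hW2]
    omega
  · rw [sum_union hdisj, ← sum_union_inter (s₁ := S), ← sum_sdiff hW2]
    ring

lemma Redistribution.exists_sum_le {n : ℕ} {b c : Fin n → ℝ} {A B A' B' : Finset (Fin n)}
    (h : Redistribution b c A B A' B') (hbc : ∀ i, b i ≤ c i) (I J : Finset (Fin n))
    (hIJ : I.card = J.card) :
    ∃ I' J' : Finset (Fin n), I'.card = I.card ∧ J'.card = I.card ∧
      ∑ i ∈ I', effCost b c A' i + ∑ i ∈ J', effCost b c B' i ≤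
        ∑ i ∈ I, effCost b c A i + ∑ i ∈ J, effCost b c B i := by
  obtain ⟨ℓ, e, he, hD, hb, hc, hA', hB'⟩ := h
  have heD (s : Fin ℓ) : e s ∈ symmDiff A B := hD ▸ mem_image_of_mem e (mem_univ s)
  have heAB (s : Fin ℓ) : e s ∉ A ∩ B := fun h => by
    have := heD s
    simp only [Finset.mem_symmDiff, Finset.mem_inter] at this h
    tauto
  have heA' (s : Fin ℓ) : e s ∈ A' ↔ (s : ℕ) % 2 = 1 := by
    rw [hA', mem_union, or_iff_right (heAB s), he.mem_finset_image]
    simp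
  have heB' (s : Fin ℓ) : e s ∈ B' ↔ (s : ℕ) % 2 = 0 := by
    rw [hB', mem_union, or_iff_right (heAB s), he.mem_finset_image]
    simp
  have hout (X : Finset (Fin n)) (i : Fin n) (hX : i ∈ X ↔ i ∈ A ∩ B) :
      effCost b c X i = effCost b c (A ∩ B) i := by
    simp only [effCost, hX]
  have houtA (i) (hi : i ∉ symmDiff A B) : i ∈ A ↔ i ∈ A ∩ B := by
    simp only [Finset.mem_symmDiff, Finset.mem_inter] at hi ⊢; tauto
  have houtB (i) (hi : i ∉ symmDiff A B) : i ∈ B ↔ i ∈ A ∩ B := by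
    simp only [Finset.mem_symmDiff, Finset.mem_inter] at hi ⊢; tauto
  have himg (S : Finset (Fin ℓ)) (i) (hi : i ∉ symmDiff A B) : i ∉ image e S := fun h =>
    hi (hD ▸ Finset.image_subset_image (subset_univ _) h)
  have houtA' (i) (hi : i ∉ symmDiff A B) : i ∈ A' ↔ i ∈ A ∩ B := by
    rw [hA', mem_union, or_iff_left (himg _ i hi)]
  have houtB' (i) (hi : i ∉ symmDiff A B) : i ∈ B' ↔ i ∈ A ∩ B := by
    rw [hB', mem_union, or_iff_left (himg _ i hi)]
  have hdec (K : Finset (Fin n)) :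
      K ∩ symmDiff A B = image e (univ.filter fun s => e s ∈ K) := by
    rw [← hD]
    ext i
    simp only [mem_inter, mem_image, mem_univ, true_and, mem_filter]
    constructor
    · rintro ⟨h, s, rfl⟩
      exact ⟨s, h, rfl⟩
    · rintro ⟨s, h, rfl⟩
      exact ⟨h, s, rfl⟩
  have hsum (K : Finset (Fin n)) (f : Fin n → ℝ) :
      ∑ i ∈ K, f i = ∑ s ∈ univ.filter (fun s => e s ∈ K), f (e s) +
        ∑ i ∈ K \ symmDiff A B, f i := by
    rw [← sum_inter_add_sum_sdiff K (symmDiff A B), hdec, sum_image he.injOn]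
  have hcard (K : Finset (Fin n)) :
      K.card = (univ.filter (fun s => e s ∈ K)).card + (K \ symmDiff A B).card := by
    rw [← card_inter_add_card_sdiff K (symmDiff A B), hdec, card_image_of_injective _ he]
  set P : Finset (Fin ℓ) := univ.filter fun s => e s ∈ I with hP
  set Q : Finset (Fin ℓ) := univ.filter fun s => e s ∈ J with hQ
  set x := (P ∩ Q).card with hx
  set y := (P ∪ Q).card with hy
  have hxy : x ≤ y := card_le_card (inter_subset_left.trans subset_union_left)
  have hyℓ : y ≤ ℓ := by simpa using card_le_univ (P ∪ Q)
  have hxyPQ : y + x = P.card + Q.card := card_union_add_card_inter P Q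
  -- The part of the sum inside the symmetric difference.
  have hfst : ∑ s ∈ P ∪ Q, b (e s) + ∑ s ∈ P ∩ Q, c (e s) ≤
      ∑ s ∈ P, effCost b c A (e s) + ∑ s ∈ Q, effCost b c B (e s) := by
    rw [← filter_univ_mem (P ∪ Q), ← filter_univ_mem (P ∩ Q), ← filter_univ_mem P,
      ← filter_univ_mem Q]
    simp only [sum_filter, ← sum_add_distrib]
    refine sum_le_sum fun s _ => ?_
    have h1 := heD s
    have h2 := hbc (e s)
    rw [Finset.mem_symmDiff] at h1
    simp only [effCost, mem_union, mem_inter, mem_filter, mem_univ, true_and]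
    rcases h1 with ⟨h1, h1'⟩ | ⟨h1, h1'⟩ <;> by_cases hp : s ∈ P <;> by_cases hq : s ∈ Q <;>
      simp [hp, hq, h1, h1'] <;> linarith
  have hpre (f : Fin n → ℝ) (hf : Monotone (f ∘ e)) (S : Finset (Fin ℓ)) :
      ∑ s ∈ univ.filter (fun s : Fin ℓ => (s : ℕ) < S.card), f (e s) ≤ ∑ s ∈ S, f (e s) := by
    refine sum_le_sum_of_forall_notMem ?_ fun t ht s hs => hf ?_
    · have := card_le_univ S
      rw [Fintype.card_fin] at this
      rw [Fin.card_filter_val_lt, min_eq_right this]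
    · simp only [mem_filter, mem_univ, true_and] at ht hs
      exact Fin.le_def.2 (by omega)
  set P' : Finset (Fin ℓ) :=
    univ.filter fun s => (s : ℕ) < x ∨ ((s : ℕ) < y ∧ (s : ℕ) % 2 = 1) with hP'
  set Q' : Finset (Fin ℓ) :=
    univ.filter fun s => (s : ℕ) < x ∨ ((s : ℕ) < y ∧ (s : ℕ) % 2 = 0) with hQ'
  have hP'card : P'.card = _ := card_filter_lt_or_mod_two hxy hyℓ (by norm_num)
  have hQ'card : Q'.card = _ := card_filter_lt_or_mod_two hxy hyℓ (by norm_num)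
  have hsnd : ∑ s ∈ P', effCost b c A' (e s) + ∑ s ∈ Q', effCost b c B' (e s) =
      ∑ s ∈ univ.filter (fun s : Fin ℓ => (s : ℕ) < y), b (e s) +
        ∑ s ∈ univ.filter (fun s : Fin ℓ => (s : ℕ) < x), c (e s) := by
    simp only [hP', hQ', sum_filter, ← sum_add_distrib]
    refine sum_congr rfl fun s _ => ?_
    simp only [effCost, heA', heB']
    rcases Nat.mod_two_eq_zero_or_one s with hs | hs <;> by_cases h1 : (s : ℕ) < x <;>
      by_cases h2 : (s : ℕ) < y <;> simp [hs, h1, h2] <;> first | omega | ring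
  -- The part outside the symmetric difference.
  have hcI : I.card = P.card + (I \ symmDiff A B).card := hcard I
  have hcJ : J.card = Q.card + (J \ symmDiff A B).card := hcard J
  obtain ⟨S, T, hS, hT, hSc, hSTc, hST⟩ := exists_rebalance (I \ symmDiff A B)
    (J \ symmDiff A B) (effCost b c (A ∩ B)) (u := I.card - P'.card) (by omega) (by omega)
  have hsub : (I \ symmDiff A B) ∪ (J \ symmDiff A B) ⊆ univ \ symmDiff A B :=
    union_subset (sdiff_subset_sdiff (subset_univ _) le_rfl)
      (sdiff_subset_sdiff (subset_univ _) le_rfl)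
  have hSD (i) (hi : i ∈ S) : i ∉ symmDiff A B := (mem_sdiff.1 (hsub (hS hi))).2
  have hTD (i) (hi : i ∈ T) : i ∉ symmDiff A B := (mem_sdiff.1 (hsub (hT hi))).2
  have hPS : Disjoint (image e P') S := Finset.disjoint_right.2 fun i hi => himg _ i (hSD i hi)
  have hQT : Disjoint (image e Q') T := Finset.disjoint_right.2 fun i hi => himg _ i (hTD i hi)
  refine ⟨image e P' ∪ S, image e Q' ∪ T, ?_, ?_, ?_⟩
  · rw [card_union_of_disjoint hPS, card_image_of_injective _ he]
    omega
  · rw [card_union_of_disjoint hQT, card_image_of_injective _ he]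
    omega
  · rw [sum_union hPS, sum_union hQT, sum_image he.injOn, sum_image he.injOn, hsum I, hsum J,
      sum_congr rfl fun i hi => hout A' i (houtA' i (hSD i hi)),
      sum_congr rfl fun i hi => hout B' i (houtB' i (hTD i hi)),
      sum_congr rfl fun i hi => hout A i (houtA i (mem_sdiff.1 hi).2),
      sum_congr rfl fun i hi => hout B i (houtB i (mem_sdiff.1 hi).2)]
    have h1 := hpre b hb (P ∪ Q)
    have h2 := hpre c hc (P ∩ Q)
    linarith

/-- The sum of the `m` smallest values is at most the sum over any `m` indices. -/
lemma sum_sorted_le {n m : ℕ} (hm : m ≤ n) (f : Fin n → ℝ) (I : Finset (Fin n))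
    (hI : I.card = m) :
    ∑ r : Fin n, (if (r : ℕ) < m then f (Tuple.sort f r) else 0) ≤ ∑ i ∈ I, f i := by
  rw [← sum_filter, ← sum_image (f := f) (Tuple.sort f).injective.injOn]
  refine sum_le_sum_of_forall_notMem ?_ ?_
  · rw [card_image_of_injective _ (Tuple.sort f).injective, Fin.card_filter_val_lt,
      min_eq_right hm, hI]
  · intro t ht s hs
    obtain ⟨r, rfl⟩ := (Tuple.sort f).surjective s
    obtain ⟨q, hq, rfl⟩ := mem_image.1 ht
    rw [(Tuple.sort f).injective.mem_finset_image] at hs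
    simp only [mem_filter, mem_univ, true_and] at hq hs
    exact Tuple.monotone_sort f (Fin.le_def.2 (by omega))

lemma assignCost_eq_sum_effCost {n : ℕ} (b c d : Fin n → ℝ) (X : Finset (Fin n))
    (π σ : Equiv.Perm (Fin n)) :
    assignCost b c d X π = ∑ r, effCost b c X (π (σ r)) * d (σ r) :=
  (Equiv.sum_comp σ fun j => effCost b c X (π j) * d j).symm

lemma Redistribution.cost_add_cost_le {n : ℕ} {b c d : Fin n → ℝ} {A B A' B' : Finset (Fin n)}
    (h : Redistribution b c A B A' B') (hbc : ∀ i, b i ≤ c i) (hd : ∀ j, 0 ≤ d j) :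
    cost b c d A' + cost b c d B' ≤ cost b c d A + cost b c d B := by
  obtain ⟨π, hπ⟩ := exists_assignCost_eq_cost b c d A
  obtain ⟨ρ, hρ⟩ := exists_assignCost_eq_cost b c d B
  set σ := Tuple.sort (-d)
  have hσ : Antitone (d ∘ σ) := fun i j hij => neg_le_neg_iff.1 (Tuple.monotone_sort (-d) hij)
  set α := Tuple.sort (effCost b c A')
  set β := Tuple.sort (effCost b c B')
  have hA := cost_le_assignCost b c d A' (σ.symm.trans α)
  have hB := cost_le_assignCost b c d B' (σ.symm.trans β)
  rw [assignCost_eq_sum_effCost _ _ _ _ _ σ] at hπ hρ hA hB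
  simp only [Equiv.trans_apply, Equiv.symm_apply_apply] at hA hB
  have key := sum_mul_nonneg_of_antitone
    (fun r => effCost b c A (π (σ r)) + effCost b c B (ρ (σ r)) -
      effCost b c A' (α r) - effCost b c B' (β r)) (d ∘ σ) hσ (fun r => hd _) (fun m hm => by
    set F : Finset (Fin n) := univ.filter fun r => (r : ℕ) < m with hF
    have hFc : F.card = m := by rw [hF, Fin.card_filter_val_lt, min_eq_right hm]
    have hI (τ : Equiv.Perm (Fin n)) : (image τ F).card = m := by
      rw [card_image_of_injective _ τ.injective, hFc]
    obtain ⟨I', J', hI', hJ', hle⟩ := h.exists_sum_le hbc (image (σ.trans π) F)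
      (image (σ.trans ρ) F) (by rw [hI, hI])
    rw [hI] at hI' hJ'
    have h1 := sum_sorted_le hm (effCost b c A') I' hI'
    have h2 := sum_sorted_le hm (effCost b c B') J' hJ'
    rw [sum_image (σ.trans π).injective.injOn, sum_image (σ.trans ρ).injective.injOn] at hle
    rw [← sum_filter] at h1 h2 ⊢
    simp only [sum_sub_distrib, sum_add_distrib]
    simp only [Equiv.trans_apply] at hle
    linarith)
  simp only [sub_mul, add_mul, sum_sub_distrib, sum_add_distrib, Function.comp_apply] at key
  linarith

/-- for a redistribution of a clean optimal pair the total cost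
is in fact preserved. -/
theorem stmt9 (n : ℕ) (hn : 1 ≤ n) (b c d : Fin n → ℝ)
    (hb : ∀ i, 0 ≤ b i) (hbc : ∀ i, b i ≤ c i) (hd : ∀ j, 0 ≤ d j) (k : ℕ)
    (A B A' B' : Finset (Fin n))
    (hopt : OptimalPair b c d k A B) (hclean : Clean b c A B)
    (hred : Redistribution b c A B A' B') :
    cost b c d A' + cost b c d B' = cost b c d A + cost b c d B := by
  refine le_antisymm (hred.cost_add_cost_le hbc hd) ?_
  have hlt : (A.card : ℝ) < B.card := by exact_mod_cast hopt.1.trans hopt.2.1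
  have hcard : (A'.card : ℝ) + B'.card = A.card + B.card := by
    exact_mod_cast hred.card_add_card
  have hA := hopt.line_le A'
  have hB := hopt.line_le B'
  refine le_of_mul_le_mul_left ?_ (sub_pos.2 hlt)
  rw [show (B'.card : ℝ) = A.card + B.card - A'.card by linarith] at hB
  linarith
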